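/- arXiv:2007.11677 — 2 statements merged into one kernel-verified Lean document; each statement's English description precedes it below -/
import Mathlib

section
/- Let W be a Weyl candidate on Minkowski ℝ⁴ and T its Bel–Robinson tensor. Let k ∈ ℝ⁴ be a future-pointing null vector: Σ_{α,β} η_{αβ} k^α k^β = 0 and k⁰ > 0. Then the radiant supermomentum Q^α := −Σ_{α',β,γ,δ} η^{αα'} T_{α'βγδ} k^β k^γ k^δ is lightlike and future-pointing (or zero): Σ_{α,β} η_{αβ} Q^α Q^β = 0 and Q⁰ ≥ 0. -/
/-- The Minkowski metric `η = diag(−1,1,1,1)` on `ℝ⁴` (equal to its inverse). -/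
noncomputable def η (α β : Fin 4) : ℝ :=
  if α = β then (if α = 0 then -1 else 1) else 0

/-- The 4-dimensional Levi-Civita symbol with `eps4 0 1 2 3 = 1`. -/
noncomputable def eps4 (a b c d : Fin 4) : ℝ :=
  (((b.val : ℝ) - a.val) * ((c.val : ℝ) - a.val) * ((d.val : ℝ) - a.val) *
   ((c.val : ℝ) - b.val) * ((d.val : ℝ) - b.val) * ((d.val : ℝ) - c.val)) / 12

/-- A Weyl candidate: a 4-index array with the algebraic symmetries, first
Bianchi identity and tracelessness of a Weyl tensor. -/
noncomputable def IsWeylCandidate (W : Fin 4 → Fin 4 → Fin 4 → Fin 4 → ℝ) : Prop :=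
  (∀ α β γ δ, W α β γ δ = - W β α γ δ) ∧
  (∀ α β γ δ, W α β γ δ = - W α β δ γ) ∧
  (∀ α β γ δ, W α β γ δ = W γ δ α β) ∧
  (∀ α β γ δ, W α β γ δ + W α γ δ β + W α δ β γ = 0) ∧
  (∀ β δ, ∑ α, ∑ γ, η α γ * W α β γ δ = 0)

/-- The Hodge dual `(*W)_{αβγδ} = (1/2) ε_{αβμν} η^{μρ} η^{νσ} W_{ρσγδ}`. -/
noncomputable def dual (W : Fin 4 → Fin 4 → Fin 4 → Fin 4 → ℝ)
    (α β γ δ : Fin 4) : ℝ :=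
  (1 / 2) * ∑ μ, ∑ ν, ∑ ρ, ∑ σ, eps4 α β μ ν * η μ ρ * η ν σ * W ρ σ γ δ

/-- The Bel–Robinson tensor
`T_{αβγδ} = η^{μμ'} η^{νν'} (W_{αμγν} W_{δν'βμ'} + (*W)_{αμγν} (*W)_{δν'βμ'})`. -/
noncomputable def BR (W : Fin 4 → Fin 4 → Fin 4 → Fin 4 → ℝ)
    (α β γ δ : Fin 4) : ℝ :=
  ∑ μ, ∑ μ', ∑ ν, ∑ ν', η μ μ' * η ν ν' *
    (W α μ γ ν * W δ ν' β μ' + dual W α μ γ ν * dual W δ ν' β μ')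

/-- The radiant supermomentum `Q^α = −η^{αα'} T_{α'βγδ} k^β k^γ k^δ` relative to
a null vector `k`. -/
noncomputable def radiantSupermomentum (W : Fin 4 → Fin 4 → Fin 4 → Fin 4 → ℝ)
    (k : Fin 4 → ℝ) (α : Fin 4) : ℝ :=
  -∑ α', ∑ β, ∑ γ, ∑ δ, η α α' * BR W α' β γ δ * k β * k γ * k δ


open ComplexConjugate

/-- A basis of the self-dual bivectors on complexified Minkowski space, normalised by its
electric components: `Z i (0, j) = δ i j`. -/
noncomputable def selfDualBasis : Fin 3 → Fin 4 → Fin 4 → ℂ :=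
  ![![![0, 1, 0, 0], ![-1, 0, 0, 0], ![0, 0, 0, -Complex.I], ![0, 0, Complex.I, 0]],
    ![![0, 0, 1, 0], ![0, 0, 0, Complex.I], ![-1, 0, 0, 0], ![0, -Complex.I, 0, 0]],
    ![![0, 0, 0, 1], ![0, 0, -Complex.I, 0], ![0, Complex.I, 0, 0], ![-1, 0, 0, 0]]]

/-- The self-dual complex combination `W + i *W`. -/
noncomputable def complexWeyl (W : Fin 4 → Fin 4 → Fin 4 → Fin 4 → ℝ) (α β γ δ : Fin 4) : ℂ :=
  ⟨W α β γ δ, dual W α β γ δ⟩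

theorem dual_eq (W : Fin 4 → Fin 4 → Fin 4 → Fin 4 → ℝ)
    (h : ∀ α β γ δ, W α β γ δ = - W β α γ δ) (α β γ δ : Fin 4) :
    dual W α β γ δ =
      (![![0, W 2 3 γ δ, W 3 1 γ δ, W 1 2 γ δ], ![-W 2 3 γ δ, 0, -W 0 3 γ δ, W 0 2 γ δ],
         ![-W 3 1 γ δ, W 0 3 γ δ, 0, -W 0 1 γ δ], ![-W 1 2 γ δ, -W 0 2 γ δ, W 0 1 γ δ, 0]] :
        Matrix (Fin 4) (Fin 4) ℝ) α β := by
  have h10 := h 1 0 γ δ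
  have h20 := h 2 0 γ δ
  have h30 := h 3 0 γ δ
  have h21 := h 2 1 γ δ
  have h13 := h 1 3 γ δ
  have h32 := h 3 2 γ δ
  fin_cases α <;> fin_cases β <;>
    simp [dual, Fin.sum_univ_four, η, eps4] <;> linarith

theorem complexWeyl_eq_left {W : Fin 4 → Fin 4 → Fin 4 → Fin 4 → ℝ}
    (h : ∀ α β γ δ, W α β γ δ = - W β α γ δ) (α β γ δ : Fin 4) :
    complexWeyl W α β γ δ = ∑ i : Fin 3, complexWeyl W 0 i.succ γ δ * selfDualBasis i α β := by
  have h0 (a) : W a a γ δ = 0 := by linarith [h a a γ δ]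
  have h10 := h 1 0 γ δ
  have h20 := h 2 0 γ δ
  have h30 := h 3 0 γ δ
  have h21 := h 2 1 γ δ
  have h13 := h 1 3 γ δ
  have h32 := h 3 2 γ δ
  fin_cases α <;> fin_cases β <;>
    simp [complexWeyl, dual_eq W h, Fin.sum_univ_three, Complex.ext_iff, selfDualBasis, h0] <;>
    linarith

theorem dual_symm {W : Fin 4 → Fin 4 → Fin 4 → Fin 4 → ℝ} (hW : IsWeylCandidate W)
    (i : Fin 3) (γ δ : Fin 4) : dual W 0 i.succ γ δ = dual W γ δ 0 i.succ := by
  obtain ⟨hl, hr, hs, hb, ht⟩ := hW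
  have h0 (α β γ) : W α β γ γ = 0 := by linarith [hr α β γ γ]
  have ht' (β δ) : W 0 β 0 δ = W 1 β 1 δ + W 2 β 2 δ + W 3 β 3 δ := by
    have := ht β δ
    simp [Fin.sum_univ_four, η] at this
    linarith
  fin_cases i <;> fin_cases γ <;> fin_cases δ <;> simp [dual_eq W hl, h0] <;> grind

theorem complexWeyl_symm {W : Fin 4 → Fin 4 → Fin 4 → Fin 4 → ℝ} (hW : IsWeylCandidate W)
    (i : Fin 3) (γ δ : Fin 4) : complexWeyl W 0 i.succ γ δ = complexWeyl W γ δ 0 i.succ := by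
  rw [complexWeyl, complexWeyl, dual_symm hW, hW.2.2.1]

theorem complexWeyl_eq {W : Fin 4 → Fin 4 → Fin 4 → Fin 4 → ℝ} (hW : IsWeylCandidate W)
    (α β γ δ : Fin 4) :
    complexWeyl W α β γ δ = ∑ i : Fin 3, ∑ j : Fin 3,
      complexWeyl W 0 i.succ 0 j.succ * selfDualBasis i α β * selfDualBasis j γ δ := by
  rw [complexWeyl_eq_left hW.1]
  refine Finset.sum_congr rfl fun i _ ↦ ?_
  rw [complexWeyl_symm hW, complexWeyl_eq_left hW.1, Finset.sum_mul]
  refine Finset.sum_congr rfl fun j _ ↦ ?_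
  rw [complexWeyl_symm hW j]
  ring

theorem BR_eq {W : Fin 4 → Fin 4 → Fin 4 → Fin 4 → ℝ} (α β γ δ : Fin 4) :
    BR W α β γ δ = (∑ μ, ∑ ν, (η μ μ * η ν ν : ℝ) *
      (complexWeyl W α μ γ ν * conj (complexWeyl W δ ν β μ))).re := by
  have h (μ ν : Fin 4) (hμν : ν ≠ μ) : η μ ν = 0 := if_neg hμν.symm
  simp only [BR, Complex.re_sum]
  refine Finset.sum_congr rfl fun μ _ ↦ ?_
  rw [Finset.sum_eq_single μ (fun _ _ hμ ↦ by simp [h _ _ hμ]) (by simp)]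
  refine Finset.sum_congr rfl fun ν _ ↦ ?_
  rw [Finset.sum_eq_single ν (fun _ _ hν ↦ by simp [h _ _ hν]) (by simp)]
  simp [-Complex.ofReal_mul, complexWeyl]

/-- The contraction of the self-dual basis bivector `Z i` with `k` in its first slot. -/
noncomputable def selfDualContraction (k : Fin 4 → ℝ) (i : Fin 3) (ν : Fin 4) : ℂ :=
  ∑ γ, selfDualBasis i γ ν * k γ

/-- The hermitian matrix of Minkowski products of the covectors `selfDualContraction k i`; it has
rank at most one when `k` is null. -/
noncomputable def contractionGram (k : Fin 4 → ℝ) (i j : Fin 3) : ℂ :=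
  ∑ ν, (η ν ν : ℝ) * (selfDualContraction k i ν * conj (selfDualContraction k j ν))

theorem contractionGram_mul (k : Fin 4 → ℝ) (hk : k 0 ^ 2 = k 1 ^ 2 + k 2 ^ 2 + k 3 ^ 2)
    (i j l : Fin 3) : contractionGram k i j * contractionGram k l l =
      contractionGram k i l * conj (contractionGram k j l) := by
  have hI := Complex.I_sq
  replace hk : (k 0 ^ 2 : ℂ) = k 1 ^ 2 + k 2 ^ 2 + k 3 ^ 2 := by exact_mod_cast hk
  fin_cases i <;> fin_cases j <;> fin_cases l <;>
    simp [contractionGram, selfDualContraction, Fin.sum_univ_four, η, selfDualBasis] <;> grind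

theorem contractionGram_self (k : Fin 4 → ℝ) (hk : k 0 ^ 2 = k 1 ^ 2 + k 2 ^ 2 + k 3 ^ 2)
    (i : Fin 3) :
    contractionGram k i i = (2 * (k 0 ^ 2 - k i.succ ^ 2) : ℝ) := by
  have hI := Complex.I_sq
  replace hk : (k 0 ^ 2 : ℂ) = k 1 ^ 2 + k 2 ^ 2 + k 3 ^ 2 := by exact_mod_cast hk
  fin_cases i <;>
    simp [contractionGram, selfDualContraction, Fin.sum_univ_four, η, selfDualBasis] <;> grind

theorem sum_mul_conj_mul_contractionGram (k : Fin 4 → ℝ)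
    (hk : k 0 ^ 2 = k 1 ^ 2 + k 2 ^ 2 + k 3 ^ 2) (a b : Fin 3 → ℂ) (l : Fin 3) :
    (∑ ν, (η ν ν : ℝ) * ((∑ j, a j * selfDualContraction k j ν) *
        conj (∑ j, b j * selfDualContraction k j ν))) * contractionGram k l l =
      (∑ j, a j * contractionGram k j l) * conj (∑ j, b j * contractionGram k j l) := by
  have h : ∑ ν, (η ν ν : ℝ) * ((∑ j, a j * selfDualContraction k j ν) *
        conj (∑ j, b j * selfDualContraction k j ν)) =
      ∑ i, ∑ j, a i * conj (b j) * contractionGram k i j := by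
    simp only [contractionGram, map_add, map_mul, Fin.sum_univ_three, Fin.sum_univ_four]
    ring
  rw [h, map_sum, Finset.sum_mul_sum, Finset.sum_mul]
  refine Finset.sum_congr rfl fun i _ ↦ ?_
  rw [Finset.sum_mul]
  refine Finset.sum_congr rfl fun j _ ↦ ?_
  rw [map_mul, mul_assoc, contractionGram_mul k hk]
  ring

/-- The contraction `T_{αβ} k^β` of the energy-momentum tensor of the self-dual Maxwell field with
components `g` in the basis `selfDualBasis`. -/
noncomputable def maxwellCurrent (g : Fin 3 → ℂ) (k : Fin 4 → ℝ) (α : Fin 4) : ℝ :=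
  (∑ μ, (η μ μ : ℝ) * ((∑ i, g i * selfDualBasis i α μ) *
    conj (∑ i, g i * selfDualContraction k i μ))).re

theorem maxwellCurrent_null (g : Fin 3 → ℂ) (k : Fin 4 → ℝ)
    (hk : k 0 ^ 2 = k 1 ^ 2 + k 2 ^ 2 + k 3 ^ 2) :
    maxwellCurrent g k 0 ^ 2 = maxwellCurrent g k 1 ^ 2 + maxwellCurrent g k 2 ^ 2 +
      maxwellCurrent g k 3 ^ 2 := by
  simp [maxwellCurrent, selfDualContraction, Fin.sum_univ_three, Fin.sum_univ_four, η,
    selfDualBasis]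
  generalize (g 0).re = x0, (g 1).re = x1, (g 2).re = x2,
    (g 0).im = y0, (g 1).im = y1, (g 2).im = y2
  grind

theorem maxwellCurrent_zero_nonneg (g : Fin 3 → ℂ) (k : Fin 4 → ℝ)
    (hk : k 0 ^ 2 = k 1 ^ 2 + k 2 ^ 2 + k 3 ^ 2) (hk0 : 0 < k 0) :
    0 ≤ maxwellCurrent g k 0 := by
  refine nonneg_of_mul_nonneg_right (a := k 0) ?_ hk0
  simp [maxwellCurrent, selfDualContraction, Fin.sum_univ_three, Fin.sum_univ_four, η,
    selfDualBasis]
  generalize (g 0).re = x0, (g 1).re = x1, (g 2).re = x2,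
    (g 0).im = y0, (g 1).im = y1, (g 2).im = y2
  have h : 0 ≤ (k 0 * x0 + (y1 * k 3 - y2 * k 2)) ^ 2 + (k 0 * x1 + (y2 * k 1 - y0 * k 3)) ^ 2 +
      (k 0 * x2 + (y0 * k 2 - y1 * k 1)) ^ 2 + (k 1 * y0 + k 2 * y1 + k 3 * y2) ^ 2 := by positivity
  linear_combination h - (y0 ^ 2 + y1 ^ 2 + y2 ^ 2) * hk

theorem sum_sum_sum_comm {ι M : Type*} [Fintype ι] [AddCommMonoid M]
    (f : ι → ι → ι → ι → ι → M) :
    ∑ β, ∑ γ, ∑ δ, ∑ μ, ∑ ν, f β γ δ μ ν = ∑ μ, ∑ ν, ∑ β, ∑ γ, ∑ δ, f β γ δ μ ν := by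
  have h (g : ι → ι → ι → M) : ∑ x, ∑ μ, ∑ ν, g x μ ν = ∑ μ, ∑ ν, ∑ x, g x μ ν := by
    rw [Finset.sum_comm]
    exact Finset.sum_congr rfl fun μ _ ↦ Finset.sum_comm
  calc
    _ = ∑ β, ∑ γ, ∑ μ, ∑ ν, ∑ δ, f β γ δ μ ν :=
      Finset.sum_congr rfl fun β _ ↦ Finset.sum_congr rfl fun γ _ ↦ h _
    _ = ∑ β, ∑ μ, ∑ ν, ∑ γ, ∑ δ, f β γ δ μ ν := Finset.sum_congr rfl fun β _ ↦ h _
    _ = _ := h _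

theorem BR_contraction_mul_contractionGram {W : Fin 4 → Fin 4 → Fin 4 → Fin 4 → ℝ}
    (hW : IsWeylCandidate W) (k : Fin 4 → ℝ) (hk : k 0 ^ 2 = k 1 ^ 2 + k 2 ^ 2 + k 3 ^ 2)
    (l : Fin 3) (α : Fin 4) :
    (∑ β, ∑ γ, ∑ δ, BR W α β γ δ * k β * k γ * k δ) * (contractionGram k l l).re =
      maxwellCurrent (fun i ↦ ∑ j, complexWeyl W 0 i.succ 0 j.succ * contractionGram k j l) k
        α := by
  obtain ⟨F, hF⟩ : ∃ F : Fin 3 → Fin 3 → ℂ, ∀ i j, complexWeyl W 0 i.succ 0 j.succ = F i j :=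
    ⟨_, fun _ _ ↦ rfl⟩
  have hFs (i j) : F i j = F j i := by rw [← hF, ← hF, complexWeyl_symm hW]
  have hC := complexWeyl_eq hW
  simp only [hF] at hC ⊢
  have h1 (μ ν : Fin 4) : ∑ γ, complexWeyl W α μ γ ν * k γ =
      ∑ j, (∑ i, F i j * selfDualBasis i α μ) * selfDualContraction k j ν := by
    simp only [hC, selfDualContraction, Fin.sum_univ_three, Fin.sum_univ_four]
    ring
  have h2 (μ ν : Fin 4) : ∑ β, ∑ δ, complexWeyl W δ ν β μ * k β * k δ =
      ∑ j, (∑ i, F i j * selfDualContraction k i μ) * selfDualContraction k j ν := by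
    simp only [hC, selfDualContraction, Fin.sum_univ_three, Fin.sum_univ_four]
    simp only [hFs 1 0, hFs 2 0, hFs 2 1]
    ring
  have h3 : ∑ β, ∑ γ, ∑ δ, BR W α β γ δ * k β * k γ * k δ =
      (∑ μ, (η μ μ : ℝ) * ∑ ν, (η ν ν : ℝ) * ((∑ γ, complexWeyl W α μ γ ν * k γ) *
        conj (∑ β, ∑ δ, complexWeyl W δ ν β μ * k β * k δ))).re := by
    simp only [← Complex.re_mul_ofReal, ← Complex.re_sum, BR_eq, Finset.sum_mul]
    congr 1
    rw [sum_sum_sum_comm]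
    refine Finset.sum_congr rfl fun μ _ ↦ ?_
    rw [Finset.mul_sum]
    refine Finset.sum_congr rfl fun ν _ ↦ ?_
    simp only [map_sum, map_mul, Complex.conj_ofReal, Finset.mul_sum]
    rw [Finset.sum_comm]
    refine Finset.sum_congr rfl fun γ _ ↦ Finset.sum_congr rfl fun β _ ↦
      Finset.sum_congr rfl fun δ _ ↦ ?_
    push_cast
    ring
  have hre : contractionGram k l l = ((contractionGram k l l).re : ℂ) := by
    rw [contractionGram_self k hk, Complex.ofReal_re]
  rw [h3, ← Complex.re_mul_ofReal, ← hre, Finset.sum_mul, maxwellCurrent]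
  congr 1
  refine Finset.sum_congr rfl fun μ _ ↦ ?_
  simp only [h1, h2]
  rw [mul_assoc, sum_mul_conj_mul_contractionGram k hk]
  congr 2
  · simp only [Finset.sum_mul]
    rw [Finset.sum_comm]
    exact Finset.sum_congr rfl fun i _ ↦ Finset.sum_congr rfl fun j _ ↦ by ring
  · simp only [Finset.sum_mul]
    rw [Finset.sum_comm]
    exact congrArg _ (Finset.sum_congr rfl fun i _ ↦ Finset.sum_congr rfl fun j _ ↦ by
      rw [hFs]; ring)

/-- For a future-pointing null vector `k`, the radiant supermomentum of the
Bel–Robinson tensor is lightlike and future-pointing (or zero). -/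
theorem radiantSupermomentum_lightlike_future
    (W : Fin 4 → Fin 4 → Fin 4 → Fin 4 → ℝ) (hW : IsWeylCandidate W)
    (k : Fin 4 → ℝ)
    (hk : ∑ α, ∑ β, η α β * k α * k β = 0) (hk0 : 0 < k 0) :
    (∑ α, ∑ β, η α β * radiantSupermomentum W k α * radiantSupermomentum W k β = 0) ∧
    (0 ≤ radiantSupermomentum W k 0) := by
  have hk' : k 0 ^ 2 = k 1 ^ 2 + k 2 ^ 2 + k 3 ^ 2 := by
    simp [Fin.sum_univ_four, η] at hk
    linarith
  obtain ⟨l, hl⟩ : ∃ l : Fin 3, 0 < (contractionGram k l l).re := by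
    by_contra! h
    have h0 := h 0
    have h1 := h 1
    have h2 := h 2
    simp only [contractionGram_self k hk', Complex.ofReal_re, Fin.succ_zero_eq_one,
      Fin.succ_one_eq_two, show (2 : Fin 3).succ = 3 from rfl] at h0 h1 h2
    linarith [pow_pos hk0 2]
  obtain ⟨g, hg⟩ : ∃ g, ∀ α, radiantSupermomentum W k α * (contractionGram k l l).re =
      -η α α * maxwellCurrent g k α := by
    refine ⟨fun i ↦ ∑ j, complexWeyl W 0 i.succ 0 j.succ * contractionGram k j l, fun α ↦ ?_⟩
    rw [← BR_contraction_mul_contractionGram hW k hk' l α, ← mul_assoc, radiantSupermomentum,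
      Finset.sum_eq_single α (fun β _ hβ ↦ by simp [η, hβ.symm]) (by simp)]
    simp only [mul_assoc, ← Finset.mul_sum, neg_mul]
  have h0 := hg 0
  have h1 := hg 1
  have h2 := hg 2
  have h3 := hg 3
  simp [η] at h0 h1 h2 h3
  constructor
  · have := maxwellCurrent_null g k hk'
    refine (mul_eq_zero_iff_right (pow_pos hl 2).ne').mp ?_
    simp [Fin.sum_univ_four, η]
    grind
  · refine nonneg_of_mul_nonneg_left ?_ hl
    rw [h0]
    exact maxwellCurrent_zero_nonneg g k hk' hk0
end

section
/- Let W be a Weyl candidate on Minkowski ℝ⁴ and T its Bel–Robinson tensor, and define the electric and magnetic parts D_{ab} := W_{0a0b} and C_{ab} := (*W)_{0a0b} for a, b ∈ {1,2,3}. Then the superenergy density with respect to the unit timelike vector e₀ decomposes as T_{0000} = Σ_{a,b} D_{ab}² + Σ_{a,b} C_{ab}². In particular T_{0000} ≥ 0, with equality if and only if D = 0 and C = 0. -/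
/-- The electric part `D_{ab} = W_{0a0b}` of a Weyl candidate with respect to `e₀`. -/
noncomputable def electricPart (W : Fin 4 → Fin 4 → Fin 4 → Fin 4 → ℝ) :
    Matrix (Fin 3) (Fin 3) ℝ :=
  Matrix.of fun a b => W 0 a.succ 0 b.succ

/-- The magnetic part `C_{ab} = (*W)_{0a0b}` of a Weyl candidate with respect to `e₀`. -/
noncomputable def magneticPart (W : Fin 4 → Fin 4 → Fin 4 → Fin 4 → ℝ) :
    Matrix (Fin 3) (Fin 3) ℝ :=
  Matrix.of fun a b => dual W 0 a.succ 0 b.succ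

/-- Contracting both index pairs of two arrays with `η` collapses to a signed double sum. -/
theorem sum_η_mul_η (f : Fin 4 → Fin 4 → Fin 4 → Fin 4 → ℝ) :
    ∑ μ, ∑ μ', ∑ ν, ∑ ν', η μ μ' * η ν ν' * f μ μ' ν ν'
      = ∑ μ, ∑ ν, η μ μ * η ν ν * f μ μ ν ν := by
  refine Finset.sum_congr rfl fun μ _ => ?_
  rw [Finset.sum_eq_single μ (fun μ' _ h => by simp [η, h.symm]) (by simp)]
  refine Finset.sum_congr rfl fun ν _ => ?_
  exact Finset.sum_eq_single ν (fun ν' _ h => by simp [η, h.symm]) (by simp)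

theorem dual_eq_sum (W : Fin 4 → Fin 4 → Fin 4 → Fin 4 → ℝ) (α β γ δ : Fin 4) :
    dual W α β γ δ = (1 / 2) * ∑ μ, ∑ ν, eps4 α β μ ν * η μ μ * η ν ν * W μ ν γ δ := by
  unfold dual
  congr 1
  refine Finset.sum_congr rfl fun μ _ => Finset.sum_congr rfl fun ν _ => ?_
  rw [Finset.sum_eq_single μ (fun ρ _ h => by simp [η, h.symm]) (by simp)]
  exact Finset.sum_eq_single ν (fun σ _ h => by simp [η, h.symm]) (by simp)

theorem dual_self_left (W : Fin 4 → Fin 4 → Fin 4 → Fin 4 → ℝ) (α γ δ : Fin 4) :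
    dual W α α γ δ = 0 := by
  simp [dual, eps4]

namespace IsWeylCandidate

variable {W : Fin 4 → Fin 4 → Fin 4 → Fin 4 → ℝ}

theorem self_left (hW : IsWeylCandidate W) (α γ δ : Fin 4) : W α α γ δ = 0 := by
  linarith [hW.1 α α γ δ]

theorem self_right (hW : IsWeylCandidate W) (α β γ : Fin 4) : W α β γ γ = 0 := by
  linarith [hW.2.1 α β γ γ]

theorem dual_self_right (hW : IsWeylCandidate W) (α β γ : Fin 4) : dual W α β γ γ = 0 := by
  simp [dual, hW.self_right]

theorem trace_eq_zero (hW : IsWeylCandidate W) (β δ : Fin 4) :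
    -W 0 β 0 δ + W 1 β 1 δ + W 2 β 2 δ + W 3 β 3 δ = 0 := by
  have h := hW.2.2.2.2 β δ
  simpa [Fin.sum_univ_four, η] using h

/-- The magnetic part is symmetric, because `W` is trace-free. -/
theorem dual_zero_symm (hW : IsWeylCandidate W) (a b : Fin 3) :
    dual W 0 a.succ 0 b.succ = dual W 0 b.succ 0 a.succ := by
  have t₁ := hW.trace_eq_zero 1 0
  have t₂ := hW.trace_eq_zero 2 0
  have t₃ := hW.trace_eq_zero 3 0
  obtain ⟨h₁, h₂, -⟩ := hW
  fin_cases a <;> fin_cases b <;>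
    simp [dual_eq_sum, Fin.sum_univ_four, eps4, η] <;>
    norm_num <;>
    grind

/-- `T₀₀₀₀` is the sum of squares of the electric and magnetic parts. -/
theorem BR_zero_eq (hW : IsWeylCandidate W) :
    BR W 0 0 0 0 =
      (∑ a, ∑ b, (electricPart W a b) ^ 2) + (∑ a, ∑ b, (magneticPart W a b) ^ 2) := by
  have hη (a : Fin 3) : η a.succ a.succ = 1 := by simp [η]
  have hs (a b : Fin 3) : W 0 b.succ 0 a.succ = W 0 a.succ 0 b.succ := hW.2.2.1 _ _ _ _
  unfold BR
  rw [sum_η_mul_η fun μ μ' ν ν' => W 0 μ 0 ν * W 0 ν' 0 μ' + dual W 0 μ 0 ν * dual W 0 ν' 0 μ']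
  simp only [Fin.sum_univ_succ (n := 3), hη, hW.self_left, hW.self_right, dual_self_left,
    hW.dual_self_right, mul_zero, add_zero, zero_add, Finset.sum_const_zero, one_mul,
    electricPart, magneticPart, Matrix.of_apply, ← Finset.sum_add_distrib]
  refine Finset.sum_congr rfl fun a _ => Finset.sum_congr rfl fun b _ => ?_
  rw [hs a b, hW.dual_zero_symm b a, sq, sq]

end IsWeylCandidate

theorem Matrix.sum_sq_nonneg {m n : Type*} [Fintype m] [Fintype n] (A : Matrix m n ℝ) :
    0 ≤ ∑ a, ∑ b, A a b ^ 2 :=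
  Finset.sum_nonneg fun _ _ => Finset.sum_nonneg fun _ _ => sq_nonneg _

theorem Matrix.sum_sq_eq_zero_iff {m n : Type*} [Fintype m] [Fintype n] (A : Matrix m n ℝ) :
    ∑ a, ∑ b, A a b ^ 2 = 0 ↔ A = 0 := by
  rw [Fintype.sum_eq_zero_iff_of_nonneg fun a => Finset.sum_nonneg fun b _ => sq_nonneg (A a b),
    funext_iff, ← Matrix.ext_iff]
  refine forall_congr' fun a => ?_
  simp [Finset.sum_eq_zero_iff_of_nonneg, sq_nonneg]

/-- The superenergy density `T_{0000} = D_{ab} D^{ab} + C_{ab} C^{ab}` is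
non-negative, vanishing iff both the electric and magnetic parts vanish. -/
theorem BR_superenergy_decomposition
    (W : Fin 4 → Fin 4 → Fin 4 → Fin 4 → ℝ) (hW : IsWeylCandidate W) :
    (BR W 0 0 0 0
      = (∑ a, ∑ b, (electricPart W a b) ^ 2) + (∑ a, ∑ b, (magneticPart W a b) ^ 2)) ∧
    (0 ≤ BR W 0 0 0 0) ∧
    (BR W 0 0 0 0 = 0 ↔ electricPart W = 0 ∧ magneticPart W = 0) := by
  rw [hW.BR_zero_eq]
  refine ⟨rfl, add_nonneg (Matrix.sum_sq_nonneg _) (Matrix.sum_sq_nonneg _), ?_⟩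
  rw [add_eq_zero_iff_of_nonneg (Matrix.sum_sq_nonneg _) (Matrix.sum_sq_nonneg _),
    Matrix.sum_sq_eq_zero_iff, Matrix.sum_sq_eq_zero_iff]
end
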